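/- For 0 < q < 1 and -1 < α < q, the functions e_n(z) = z^n/√((-α;q)_n [n]_q!) form an orthonormal system in L²(ℂ_q, ν_{q,α}) where ν_{q,α}(d²z) = (1/2π) dθ · ρ_{q,α}(dr) in polar coordinates z = re^{iθ}, and ρ_{q,α} is the discrete measure (-α;q)_∞(q;q)_∞ ∑_{n≥0} (q^n/(q;q)_n) h_n(-α/q|q) δ_{(1-q)^{-1/2}q^{n/2}}. -/

import Mathlib

open Complex

/-- q-Pochhammer symbol `(a;q)_n`. -/
noncomputable def qPoch (a q : ℝ) (n : ℕ) : ℝ := ∏ j ∈ Finset.range n, (1 - a * q ^ j)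

/-- infinite q-Pochhammer symbol `(a;q)_∞`. -/
noncomputable def qPochInf (a q : ℝ) : ℝ := ∏' j : ℕ, (1 - a * q ^ j)

/-- q-factorial `[n]_q!`. -/
noncomputable def qFact (q : ℝ) (n : ℕ) : ℝ :=
  ∏ k ∈ Finset.range n, ((1 - q ^ (k + 1)) / (1 - q))

/-- Rogers–Szegő polynomial `h_n(z|q)`. -/
noncomputable def rogersSzego (q : ℝ) (n : ℕ) (z : ℝ) : ℝ :=
  ∑ k ∈ Finset.range (n + 1),
    (qPoch q q n / (qPoch q q k * qPoch q q (n - k))) * z ^ k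

/-- The monomials `e_n(z) = z^n/√((-α;q)_n [n]_q!)`. -/
noncomputable def e (q α : ℝ) (n : ℕ) (z : ℂ) : ℂ :=
  z ^ n / ((Real.sqrt (qPoch (-α) q n * qFact q n) : ℝ) : ℂ)

open Filter Topology

lemma one_sub_pow_pos {q : ℝ} (hq : 0 < q) (hq1 : q < 1) (k : ℕ) : 0 < 1 - q ^ (k + 1) := by
  have := pow_lt_one₀ hq.le hq1 (Nat.succ_ne_zero k)
  simpa using this

lemma qPoch_self_pos {q : ℝ} (hq : 0 < q) (hq1 : q < 1) (k : ℕ) : 0 < qPoch q q k := by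
  refine Finset.prod_pos fun j _ => ?_
  simpa [pow_succ'] using one_sub_pow_pos hq hq1 j

lemma qPoch_zero (a q : ℝ) : qPoch a q 0 = 1 := by simp [qPoch]

lemma qPoch_succ (a q : ℝ) (n : ℕ) : qPoch a q (n + 1) = qPoch a q n * (1 - a * q ^ n) := by
  simp [qPoch, Finset.prod_range_succ]

lemma qPoch_add (a q : ℝ) (n N : ℕ) :
    qPoch a q (n + N) = qPoch a q n * qPoch (a * q ^ n) q N := by
  simp only [qPoch, Finset.prod_range_add]
  simp [pow_add, mul_assoc]

lemma tendsto_qPoch {q : ℝ} (hq : 0 < q) (hq1 : q < 1) (a : ℝ) :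
    Tendsto (qPoch a q) atTop (𝓝 (qPochInf a q)) := by
  have hs : Summable fun j : ℕ => ‖-(a * q ^ j)‖ :=
    ((summable_geometric_of_lt_one hq.le hq1).mul_left a).neg.norm
  have := (multipliable_one_add_of_summable hs).hasProd.tendsto_prod_nat
  simp only [← sub_eq_add_neg] at this
  exact this

lemma qPochInf_eq_qPoch_mul {q : ℝ} (hq : 0 < q) (hq1 : q < 1) (a : ℝ) (n : ℕ) :
    qPochInf a q = qPoch a q n * qPochInf (a * q ^ n) q := by
  have h1 := (tendsto_qPoch hq hq1 (a * q ^ n)).const_mul (qPoch a q n)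
  have h2 := (tendsto_add_atTop_iff_nat n).2 (tendsto_qPoch hq hq1 a)
  refine tendsto_nhds_unique h2 (h1.congr fun N => ?_)
  rw [add_comm N n, qPoch_add]

lemma summable_norm_pow_div_qPoch {q : ℝ} (hq : 0 < q) (hq1 : q < 1) {t : ℝ} (ht : |t| < 1) :
    Summable fun k : ℕ => ‖t ^ k / qPoch q q k‖ := by
  obtain ⟨r, htr, hr⟩ := exists_between ht
  have hlim : Tendsto (fun k : ℕ => |t| / (1 - q ^ (k + 1))) atTop (𝓝 |t|) := by
    have h := (tendsto_add_atTop_iff_nat 1).2 (tendsto_pow_atTop_nhds_zero_of_lt_one hq.le hq1)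
    have h' : Tendsto (fun k : ℕ => |t| / (1 - q ^ (k + 1))) atTop (𝓝 (|t| / (1 - 0))) :=
      tendsto_const_nhds.div (h.const_sub 1) (by norm_num)
    rwa [sub_zero, div_one] at h'
  refine Summable.norm (summable_of_ratio_norm_eventually_le hr ?_)
  filter_upwards [hlim.eventually_lt_const htr] with k hk
  have hp := one_sub_pow_pos hq hq1 k
  have hP := qPoch_self_pos hq hq1 k
  have : t ^ (k + 1) / qPoch q q (k + 1) = t / (1 - q ^ (k + 1)) * (t ^ k / qPoch q q k) := by
    rw [qPoch_succ, pow_succ, ← pow_succ']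
    field_simp
  rw [this, norm_mul]
  refine mul_le_mul_of_nonneg_right ?_ (norm_nonneg _)
  rw [norm_div, Real.norm_eq_abs, Real.norm_of_nonneg hp.le]
  exact hk.le

/-- Functional equation of the `q`-exponential series. -/
lemma one_sub_mul_tsum_pow_div_qPoch {q : ℝ} (hq : 0 < q) (hq1 : q < 1) {t : ℝ}
    (ht : |t| < 1) :
    (1 - t) * ∑' k : ℕ, t ^ k / qPoch q q k = ∑' k : ℕ, (t * q) ^ k / qPoch q q k := by
  have hs := (summable_norm_pow_div_qPoch hq hq1 ht).of_norm
  have htq : |t * q| < 1 := by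
    rw [abs_mul, abs_of_pos hq]
    nlinarith [abs_nonneg t]
  have hsq := (summable_norm_pow_div_qPoch hq hq1 htq).of_norm
  have h : ∑' k : ℕ, (t ^ k / qPoch q q k - (t * q) ^ k / qPoch q q k)
      = t * ∑' k : ℕ, t ^ k / qPoch q q k := by
    rw [(hs.sub hsq).tsum_eq_zero_add, ← tsum_mul_left]
    simp only [pow_zero, sub_self, zero_add]
    refine tsum_congr fun k => ?_
    have hp := one_sub_pow_pos hq hq1 k
    have hP := qPoch_self_pos hq hq1 k
    rw [qPoch_succ, ← pow_succ', mul_pow]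
    field_simp
    exact pow_succ' t k
  rw [hs.tsum_sub hsq] at h
  linarith

/-- Euler's identity `∑ t^k/(q;q)_k = 1/(t;q)_∞`. -/
lemma qPochInf_mul_tsum_pow_div_qPoch {q : ℝ} (hq : 0 < q) (hq1 : q < 1) {t : ℝ}
    (ht : |t| < 1) :
    qPochInf t q * ∑' k : ℕ, t ^ k / qPoch q q k = 1 := by
  have hle : ∀ N : ℕ, |t * q ^ N| ≤ |t| := fun N => by
    rw [abs_mul, abs_of_pos (pow_pos hq N)]
    exact mul_le_of_le_one_right (abs_nonneg t) (pow_le_one₀ hq.le hq1.le)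
  have hiter : ∀ N : ℕ, qPoch t q N * ∑' k : ℕ, t ^ k / qPoch q q k
      = ∑' k : ℕ, (t * q ^ N) ^ k / qPoch q q k := by
    intro N
    induction N with
    | zero => simp [qPoch_zero]
    | succ N ih =>
      rw [qPoch_succ, mul_right_comm, ih, mul_comm,
        one_sub_mul_tsum_pow_div_qPoch hq hq1 ((hle N).trans_lt ht), mul_assoc, ← pow_succ]
  have hlim : Tendsto (fun N : ℕ => ∑' k : ℕ, (t * q ^ N) ^ k / qPoch q q k) atTop
      (𝓝 (∑' k : ℕ, (0 : ℝ) ^ k / qPoch q q k)) := by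
    refine tendsto_tsum_of_dominated_convergence (summable_norm_pow_div_qPoch hq hq1 ht)
      (fun k => ?_) (Eventually.of_forall fun N k => ?_)
    · have h := (tendsto_pow_atTop_nhds_zero_of_lt_one hq.le hq1).const_mul t
      rw [mul_zero] at h
      exact (h.pow k).div_const _
    · rw [norm_div, norm_div, norm_pow, norm_pow]
      gcongr
      exact hle N
  have hzero : ∑' k : ℕ, (0 : ℝ) ^ k / qPoch q q k = 1 := by
    rw [tsum_eq_single 0 fun k hk => by simp [hk]]
    simp [qPoch_zero]
  rw [hzero] at hlim
  exact tendsto_nhds_unique ((tendsto_qPoch hq hq1 t).mul_const _)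
    (hlim.congr fun N => (hiter N).symm)

/-- Generating function of the Rogers–Szegő polynomials. -/
lemma qPochInf_mul_tsum_rogersSzego {q : ℝ} (hq : 0 < q) (hq1 : q < 1) {t x : ℝ}
    (ht : |t| < 1) (hxt : |x * t| < 1) :
    qPochInf (x * t) q * qPochInf t q * ∑' k : ℕ, t ^ k / qPoch q q k * rogersSzego q k x = 1 := by
  have hprod := tsum_mul_tsum_eq_tsum_sum_range_of_summable_norm
    (summable_norm_pow_div_qPoch hq hq1 hxt) (summable_norm_pow_div_qPoch hq hq1 ht)
  have hterm : ∀ k : ℕ, t ^ k / qPoch q q k * rogersSzego q k x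
      = ∑ j ∈ Finset.range (k + 1),
        (x * t) ^ j / qPoch q q j * (t ^ (k - j) / qPoch q q (k - j)) := by
    intro k
    rw [rogersSzego, Finset.mul_sum]
    refine Finset.sum_congr rfl fun j hj => ?_
    have hjk : j ≤ k := Nat.lt_succ_iff.1 (Finset.mem_range.1 hj)
    have h1 := (qPoch_self_pos hq hq1 k).ne'
    have h2 := (qPoch_self_pos hq hq1 j).ne'
    have h3 := (qPoch_self_pos hq hq1 (k - j)).ne'
    rw [← pow_mul_pow_sub t hjk, mul_pow]
    field_simp
  rw [tsum_congr hterm, ← hprod, mul_mul_mul_comm, qPochInf_mul_tsum_pow_div_qPoch hq hq1 hxt,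
    qPochInf_mul_tsum_pow_div_qPoch hq hq1 ht, one_mul]

lemma qFact_eq (q : ℝ) (n : ℕ) : qFact q n = qPoch q q n / (1 - q) ^ n := by
  simp [qFact, qPoch, Finset.prod_div_distrib, pow_succ']

/-- The even moments of `ρ_{q,α}`. -/
lemma radial_moment {q α : ℝ} (hq : 0 < q) (hq1 : q < 1) (hα : |α| < 1) (n : ℕ) :
    qPochInf (-α) q * qPochInf q q *
      ∑' k : ℕ, q ^ k / qPoch q q k * rogersSzego q k (-α / q) *
        ((√(1 - q))⁻¹ * √q ^ k) ^ (2 * n) = qPoch (-α) q n * qFact q n := by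
  have hqn : q ^ n ≤ 1 := pow_le_one₀ hq.le hq1.le
  have hx : -α / q * q ^ (n + 1) = -α * q ^ n := by rw [pow_succ]; field_simp
  have hgen := qPochInf_mul_tsum_rogersSzego hq hq1 (t := q ^ (n + 1)) (x := -α / q)
    (by rw [abs_of_pos (by positivity)]; exact pow_lt_one₀ hq.le hq1 n.succ_ne_zero)
    (by
      rw [hx, abs_mul, abs_neg, abs_of_pos (by positivity : 0 < q ^ n)]
      exact (mul_le_of_le_one_right (abs_nonneg α) hqn).trans_lt hα)
  have hterm : ∀ k : ℕ, q ^ k / qPoch q q k * rogersSzego q k (-α / q) *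
        ((√(1 - q))⁻¹ * √q ^ k) ^ (2 * n)
      = (q ^ (n + 1)) ^ k / qPoch q q k * rogersSzego q k (-α / q) * ((1 - q) ^ n)⁻¹ := by
    intro k
    have hr : ((√(1 - q))⁻¹ * √q ^ k) ^ (2 * n) = ((1 - q) ^ n)⁻¹ * (q ^ n) ^ k := by
      rw [pow_mul, mul_pow, inv_pow, Real.sq_sqrt (by linarith), ← pow_mul, mul_comm k 2, pow_mul,
        Real.sq_sqrt hq.le, mul_pow, inv_pow, ← pow_mul, ← pow_mul, mul_comm k n]
    rw [hr, pow_succ, mul_pow]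
    ring
  rw [tsum_congr hterm, tsum_mul_right, qPochInf_eq_qPoch_mul hq hq1 (-α) n,
    qPochInf_eq_qPoch_mul hq hq1 q n, ← pow_succ', qFact_eq]
  rw [hx] at hgen
  linear_combination qPoch (-α) q n * qPoch q q n * ((1 - q) ^ n)⁻¹ * hgen

lemma e_mul_conj_e (q α r θ : ℝ) (n m : ℕ) :
    e q α n (r * exp (θ * I)) * (starRingEnd ℂ) (e q α m (r * exp (θ * I)))
      = ((r ^ (n + m) / (√(qPoch (-α) q n * qFact q n) * √(qPoch (-α) q m * qFact q m)) : ℝ) : ℂ) *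
        exp (((n : ℤ) - m : ℤ) * (θ * I)) := by
  have hc : (starRingEnd ℂ) (exp (θ * I)) = exp (-(θ * I)) := by
    rw [← exp_conj]
    simp
  have he : exp (((n : ℤ) - m : ℤ) * (θ * I)) = exp (θ * I) ^ n * exp (-(θ * I)) ^ m := by
    rw [← exp_nat_mul, ← exp_nat_mul, ← exp_add]
    push_cast
    ring_nf
  rw [he]
  simp only [e, map_div₀, map_pow, map_mul, conj_ofReal, hc]
  push_cast
  ring

lemma integral_exp_int_mul (l : ℤ) :
    ∫ θ in (0 : ℝ)..(2 * Real.pi), exp (l * (θ * I)) = if l = 0 then 2 * (Real.pi : ℂ) else 0 := by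
  split_ifs with hl
  · simp [hl]
  · have hc : (l : ℂ) * I ≠ 0 := mul_ne_zero (by exact_mod_cast hl) I_ne_zero
    have h := integral_exp_mul_complex (a := 0) (b := 2 * Real.pi) hc
    have hper : exp ((l : ℂ) * I * ((2 * Real.pi : ℝ) : ℂ)) = 1 := by
      rw [← exp_int_mul_two_pi_mul_I l]
      push_cast
      ring_nf
    rw [hper] at h
    simp only [ofReal_zero, mul_zero, exp_zero, sub_self, zero_div] at h
    rw [← h]
    congr with θ
    ring_nf

lemma qPoch_mul_qFact_pos {q α : ℝ} (hq : 0 < q) (hq1 : q < 1) (hα : -1 < α) (n : ℕ) :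
    0 < qPoch (-α) q n * qFact q n := by
  refine mul_pos (Finset.prod_pos fun j _ => ?_) (Finset.prod_pos fun j _ =>
    div_pos (one_sub_pow_pos hq hq1 j) (by linarith))
  have h1 : q ^ j ≤ 1 := pow_le_one₀ hq.le hq1.le
  have h2 : 0 < q ^ j := pow_pos hq j
  nlinarith

/-- The monomials `e_n(z) = z^n/√((-α;q)_n [n]_q!)` form an orthonormal system in
`L²(ℂ_q, ν_{q,α})`, where `ν_{q,α}` is the product of the normalized angular Lebesgue
measure and the discrete radial measure
`ρ_{q,α} = (-α;q)_∞(q;q)_∞ ∑_k (q^k/(q;q)_k) h_k(-α/q|q) δ_{(1-q)^{-1/2} q^{k/2}}`. -/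
theorem monomials_orthonormal (q α : ℝ) (hq : 0 < q) (hq1 : q < 1)
    (hα : -1 < α) (hαq : α < q) :
    ∀ n m : ℕ,
      (1 / (2 * Real.pi) : ℝ) •
        ∫ θ in (0 : ℝ)..(2 * Real.pi),
          ((qPochInf (-α) q * qPochInf q q : ℝ) : ℂ) *
            ∑' k : ℕ,
              ((q ^ k / qPoch q q k * rogersSzego q k (-α / q) : ℝ) : ℂ) *
                (e q α n (((Real.sqrt (1 - q))⁻¹ * Real.sqrt q ^ k : ℝ) *
                    Complex.exp (θ * I)) *
                  (starRingEnd ℂ)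
                    (e q α m (((Real.sqrt (1 - q))⁻¹ * Real.sqrt q ^ k : ℝ) *
                      Complex.exp (θ * I))))
        = if n = m then 1 else 0 := by
  intro n m
  set A : ℕ → ℝ := fun n => qPoch (-α) q n * qFact q n
  set w : ℕ → ℝ := fun k => q ^ k / qPoch q q k * rogersSzego q k (-α / q)
  set r : ℕ → ℝ := fun k => (√(1 - q))⁻¹ * √q ^ k
  set S : ℝ := ∑' k : ℕ, w k * r k ^ (n + m) with hS
  have hint : ∀ θ : ℝ, ((qPochInf (-α) q * qPochInf q q : ℝ) : ℂ) *
      ∑' k : ℕ, (w k : ℂ) * (e q α n (r k * exp (θ * I)) *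
        (starRingEnd ℂ) (e q α m (r k * exp (θ * I))))
      = ((qPochInf (-α) q * qPochInf q q * S / (√(A n) * √(A m)) : ℝ) : ℂ) *
        exp (((n : ℤ) - m : ℤ) * (θ * I)) := by
    intro θ
    have hterm : ∀ k : ℕ, (w k : ℂ) * (e q α n (r k * exp (θ * I)) *
        (starRingEnd ℂ) (e q α m (r k * exp (θ * I))))
        = ((w k * r k ^ (n + m) : ℝ) : ℂ) *
          (((√(A n) * √(A m))⁻¹ : ℝ) * exp (((n : ℤ) - m : ℤ) * (θ * I))) := by
      intro k
      rw [e_mul_conj_e]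
      push_cast
      ring
    rw [tsum_congr hterm, tsum_mul_right, ← ofReal_tsum, ← hS]
    push_cast
    ring
  rw [intervalIntegral.integral_congr fun θ _ => hint θ, intervalIntegral.integral_const_mul,
    integral_exp_int_mul]
  rcases eq_or_ne n m with rfl | hnm
  · have hpos : 0 < A n := qPoch_mul_qFact_pos hq hq1 hα n
    have hmom : qPochInf (-α) q * qPochInf q q * S = A n := by
      rw [hS, ← two_mul]
      exact radial_moment hq hq1 (abs_lt.2 ⟨hα, hαq.trans hq1⟩) n
    have hpi : (Real.pi : ℂ) ≠ 0 := ofReal_ne_zero.2 Real.pi_ne_zero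
    rw [hmom, Real.mul_self_sqrt hpos.le, div_self hpos.ne']
    simp only [sub_self, if_true, real_smul]
    push_cast
    field_simp
  · have : (n : ℤ) - m ≠ 0 := sub_ne_zero.2 (by exact_mod_cast hnm)
    simp [this, hnm]
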